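/- Let α ∈ (0,1], β = √(1−α²), c > 0, T ∈ ℝ, and let f_{c,α} be the shrinker profile. Then the function m̃(x,t) := f_{c,α}( x/√(T−t) ), defined for (x,t) ∈ ℝ × (−∞,T), is a C^∞, S²-valued solution of ∂ₜm = β m × ∂ₓₓm − α m × (m × ∂ₓₓm) on ℝ × (−∞,T); it satisfies |∂ₓm̃(x,t)| = (c/√(T−t)) e^{αx²/(4(T−t))} for all (x,t) ∈ ℝ × (−∞,T); and m̃(·,t) → 0 as t → T⁻ in the sense of tempered distributions, i.e. for every Schwartz function φ : ℝ → ℝ³, ∫_ℝ ⟨m̃(x,t), φ(x)⟩ dx → 0 as t → T⁻. -/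

import Mathlib

noncomputable section

open Real MeasureTheory Filter Topology
open scoped RealInnerProductSpace

/-- `E3` is `ℝ³` with the Euclidean norm. -/
abbrev E3 : Type := EuclideanSpace ℝ (Fin 3)

def toE3 (v : Fin 3 → ℝ) : E3 := (WithLp.equiv 2 (Fin 3 → ℝ)).symm v

/-- The cross product in `ℝ³`. -/
def cross (a b : E3) : E3 :=
  toE3 ![a 1 * b 2 - a 2 * b 1, a 2 * b 0 - a 0 * b 2, a 0 * b 1 - a 1 * b 0]

def e1 : E3 := EuclideanSpace.single 0 1
def e2 : E3 := EuclideanSpace.single 1 1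
def e3 : E3 := EuclideanSpace.single 2 1

/-- `(f, g, h)` solves the Serret–Frenet system with curvature `k(x) = c e^{αx²/4}`,
torsion `τ(x) = -βx/2` and initial conditions `(e₁, e₂, e₃)`. -/
def IsSFShrink (α β c : ℝ) (f g h : ℝ → E3) : Prop :=
  (∀ x : ℝ, HasDerivAt f ((c * Real.exp (α * x ^ 2 / 4)) • g x) x) ∧
  (∀ x : ℝ, HasDerivAt g
    ((-(c * Real.exp (α * x ^ 2 / 4))) • f x + (-(β * x / 2)) • h x) x) ∧
  (∀ x : ℝ, HasDerivAt h ((β * x / 2) • g x) x) ∧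
  f 0 = e1 ∧ g 0 = e2 ∧ h 0 = e3

section Frenet

variable {E : Type*} [NormedAddCommGroup E] [InnerProductSpace ℝ E]

/-- `(u, v, w)` solves the Serret–Frenet system with curvature `k` and torsion `τ`. -/
def IsFrenet (k τ : ℝ → ℝ) (u v w : ℝ → E) : Prop :=
  (∀ x, HasDerivAt u (k x • v x) x) ∧
  (∀ x, HasDerivAt v (-k x • u x + τ x • w x) x) ∧
  (∀ x, HasDerivAt w (-τ x • v x) x)

lemma IsFrenet.sum_sq_norm_eq {k τ : ℝ → ℝ} {u v w : ℝ → E} (H : IsFrenet k τ u v w) (x : ℝ) :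
    ‖u x‖ ^ 2 + ‖v x‖ ^ 2 + ‖w x‖ ^ 2 = ‖u 0‖ ^ 2 + ‖v 0‖ ^ 2 + ‖w 0‖ ^ 2 := by
  obtain ⟨hu, hv, hw⟩ := H
  have hd (y : ℝ) : HasDerivAt (fun y => ‖u y‖ ^ 2 + ‖v y‖ ^ 2 + ‖w y‖ ^ 2) 0 y := by
    refine (((hu y).norm_sq.add (hv y).norm_sq).add (hw y).norm_sq).congr_deriv ?_
    simp only [inner_add_right, real_inner_smul_right]
    rw [real_inner_comm (u y) (v y), real_inner_comm (w y) (v y)]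
    ring
  exact is_const_of_deriv_eq_zero (fun y => (hd y).differentiableAt) (fun y => (hd y).deriv) x 0

lemma IsFrenet.contDiff {k τ : ℝ → ℝ} {u v w : ℝ → E} (H : IsFrenet k τ u v w)
    (hk : ContDiff ℝ (⊤ : ℕ∞) k) (hτ : ContDiff ℝ (⊤ : ℕ∞) τ) : ContDiff ℝ (⊤ : ℕ∞) u := by
  obtain ⟨hu, hv, hw⟩ := H
  have key (n : ℕ) : ContDiff ℝ n u ∧ ContDiff ℝ n v ∧ ContDiff ℝ n w := by
    induction n with
    | zero =>
      simp only [Nat.cast_zero, contDiff_zero]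
      exact ⟨continuous_iff_continuousAt.2 fun x => (hu x).continuousAt,
        continuous_iff_continuousAt.2 fun x => (hv x).continuousAt,
        continuous_iff_continuousAt.2 fun x => (hw x).continuousAt⟩
    | succ n ih =>
      obtain ⟨cu, cv, cw⟩ := ih
      have ck : ContDiff ℝ n k := hk.of_le (by exact_mod_cast le_top)
      have cτ : ContDiff ℝ n τ := hτ.of_le (by exact_mod_cast le_top)
      have step {a a' : ℝ → E} (ha : ∀ x, HasDerivAt a (a' x) x) (ha' : ContDiff ℝ n a') :
          ContDiff ℝ ((n + 1 : ℕ) : WithTop ℕ∞) a := by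
        rw [Nat.cast_add, Nat.cast_one, contDiff_succ_iff_deriv]
        refine ⟨fun x => (ha x).differentiableAt, by simp, ?_⟩
        rwa [show deriv a = a' from funext fun x => (ha x).deriv]
      exact ⟨step hu (ck.smul cv), step hv ((ck.neg.smul cu).add (cτ.smul cw)),
        step hw (cτ.neg.smul cv)⟩
  exact contDiff_infty.2 fun n => (key n).1

end Frenet

section Cross

@[simp] lemma cross_apply_zero (a b : E3) : cross a b 0 = a 1 * b 2 - a 2 * b 1 := rfl
@[simp] lemma cross_apply_one (a b : E3) : cross a b 1 = a 2 * b 0 - a 0 * b 2 := rfl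
@[simp] lemma cross_apply_two (a b : E3) : cross a b 2 = a 0 * b 1 - a 1 * b 0 := rfl

lemma E3.ext_coords {a b : E3} (h0 : a 0 = b 0) (h1 : a 1 = b 1) (h2 : a 2 = b 2) : a = b := by
  ext i
  fin_cases i <;> assumption

lemma E3.norm_sq_eq (a : E3) : ‖a‖ ^ 2 = a 0 ^ 2 + a 1 ^ 2 + a 2 ^ 2 := by
  simp [EuclideanSpace.norm_sq_eq, Fin.sum_univ_three]

lemma E3.hasDerivAt_apply {a : ℝ → E3} {a' : E3} {x : ℝ} (ha : HasDerivAt a a' x) (i : Fin 3) :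
    HasDerivAt (fun y => a y i) (a' i) x :=
  (EuclideanSpace.proj (𝕜 := ℝ) i).hasFDerivAt.comp_hasDerivAt x ha

lemma E3.hasDerivAt_of_coords {a : ℝ → E3} {a' : E3} {x : ℝ}
    (ha : ∀ i, HasDerivAt (fun y => a y i) (a' i) x) : HasDerivAt a a' x := by
  exact (EuclideanSpace.equiv (Fin 3) ℝ).symm.hasFDerivAt.comp_hasDerivAt x (hasDerivAt_pi.2 ha)

lemma HasDerivAt.cross {a b : ℝ → E3} {a' b' : E3} {x : ℝ}
    (ha : HasDerivAt a a' x) (hb : HasDerivAt b b' x) :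
    HasDerivAt (fun y => cross (a y) (b y)) (cross a' (b x) + cross (a x) b') x := by
  have A := E3.hasDerivAt_apply ha
  have B := E3.hasDerivAt_apply hb
  refine E3.hasDerivAt_of_coords fun i => ?_
  fin_cases i
  · refine (((A 1).mul (B 2)).sub ((A 2).mul (B 1))).congr_deriv ?_
    simp
    ring
  · refine (((A 2).mul (B 0)).sub ((A 0).mul (B 2))).congr_deriv ?_
    simp
    ring
  · refine (((A 0).mul (B 1)).sub ((A 1).mul (B 0))).congr_deriv ?_
    simp
    ring

/-- A solution of the Serret–Frenet system starting at a positive orthonormal frame satisfies the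
frame relations everywhere. -/
lemma IsFrenet.cross_eq {k τ : ℝ → ℝ} {u v w : ℝ → E3} (H : IsFrenet k τ u v w)
    (h0 : cross (u 0) (v 0) = w 0) (h1 : cross (v 0) (w 0) = u 0) (h2 : cross (w 0) (u 0) = v 0)
    (x : ℝ) :
    cross (u x) (v x) = w x ∧ cross (v x) (w x) = u x ∧ cross (w x) (u x) = v x := by
  have D : IsFrenet k τ (fun y => cross (v y) (w y) - u y) (fun y => cross (w y) (u y) - v y)
      (fun y => cross (u y) (v y) - w y) := by
    obtain ⟨hu, hv, hw⟩ := H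
    refine ⟨fun y => ?_, fun y => ?_, fun y => ?_⟩
    · refine (((hv y).cross (hw y)).sub (hu y)).congr_deriv ?_
      apply E3.ext_coords <;> simp <;> ring
    · refine (((hw y).cross (hu y)).sub (hv y)).congr_deriv ?_
      apply E3.ext_coords <;> simp <;> ring
    · refine (((hu y).cross (hv y)).sub (hw y)).congr_deriv ?_
      apply E3.ext_coords <;> simp <;> ring
  have S := D.sum_sq_norm_eq x
  simp only [h0, h1, h2, sub_self, norm_zero] at S
  have vanish {a : E3} (ha : ‖a‖ ^ 2 ≤ 0) : a = 0 := by
    simpa using le_antisymm ha (sq_nonneg _)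
  refine ⟨sub_eq_zero.1 (vanish ?_), sub_eq_zero.1 (vanish ?_), sub_eq_zero.1 (vanish ?_)⟩ <;>
  nlinarith [sq_nonneg ‖cross (v x) (w x) - u x‖, sq_nonneg ‖cross (w x) (u x) - v x‖,
    sq_nonneg ‖cross (u x) (v x) - w x‖]

lemma norm_sq_eq_of_cross {a b c : E3} (h0 : cross a b = c) (h1 : cross b c = a)
    (h2 : cross c a = b) : ‖a‖ ^ 2 = ‖b‖ ^ 2 ∧ ‖b‖ ^ 2 = ‖c‖ ^ 2 := by
  have e0 := congrArg (fun v : E3 => v 0) h0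
  have e1 := congrArg (fun v : E3 => v 1) h0
  have e2 := congrArg (fun v : E3 => v 2) h0
  have f0 := congrArg (fun v : E3 => v 0) h1
  have f1 := congrArg (fun v : E3 => v 1) h1
  have f2 := congrArg (fun v : E3 => v 2) h1
  have g0 := congrArg (fun v : E3 => v 0) h2
  have g1 := congrArg (fun v : E3 => v 1) h2
  have g2 := congrArg (fun v : E3 => v 2) h2
  simp only [cross_apply_zero, cross_apply_one, cross_apply_two] at *
  simp only [E3.norm_sq_eq]
  constructor
  · linear_combination b 0 * g0 + b 1 * g1 + b 2 * g2 - a 0 * f0 - a 1 * f1 - a 2 * f2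
  · linear_combination c 0 * e0 + c 1 * e1 + c 2 * e2 - b 0 * g0 - b 1 * g1 - b 2 * g2

end Cross

section Oscillation

variable {E : Type*} [NormedAddCommGroup E] [InnerProductSpace ℝ E]

/-- If `f` is bounded and is the sum of the derivative of a bounded function and an integrable
function, then `f (· / ε)` is of order `ε` when tested against a Schwartz function. -/
lemma exists_norm_integral_inner_comp_div_le {f G r : ℝ → E} {A B : ℝ}
    (hf : Continuous f) (hfA : ∀ x, ‖f x‖ ≤ A)
    (hG : ∀ x, HasDerivAt G (f x - r x) x) (hGB : ∀ x, ‖G x‖ ≤ B)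
    (hr : Integrable r) (φ : SchwartzMap ℝ E) :
    ∃ K, ∀ ε : ℝ, 0 < ε → ‖∫ x : ℝ, ⟪f (x / ε), φ x⟫‖ ≤ ε * K := by
  have hGc : Continuous G := continuous_iff_continuousAt.2 fun x => (hG x).continuousAt
  set ψ : SchwartzMap ℝ E := SchwartzMap.derivCLM ℝ E φ
  obtain ⟨M, hM⟩ : ∃ M, ∀ x, ‖φ x‖ ≤ M := ⟨_, φ.norm_le_seminorm ℝ⟩
  refine ⟨M * (∫ x, ‖r x‖) + B * ∫ x, ‖ψ x‖, fun ε hε => ?_⟩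
  have bdd {p : ℝ → E} (hp : Continuous p) {C : ℝ} (hpC : ∀ x, ‖p x‖ ≤ C)
      (χ : SchwartzMap ℝ E) : Integrable fun x => ⟪p (x / ε), χ x⟫ := by
    refine (χ.integrable.norm.const_mul C).mono' (Continuous.aestronglyMeasurable ?_) ?_
    · exact (hp.comp (continuous_id.div_const ε)).inner χ.continuous
    · refine .of_forall fun x => (norm_inner_le_norm _ _).trans ?_
      gcongr
      exact hpC _
  have hrε : Integrable fun x => r (x / ε) := hr.comp_div hε.ne'
  have hrφ_le (x : ℝ) : ‖⟪r (x / ε), φ x⟫‖ ≤ M * ‖r (x / ε)‖ := by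
    refine (norm_inner_le_norm _ _).trans ?_
    rw [mul_comm]
    gcongr
    exact hM x
  have hrφ : Integrable fun x => ⟪r (x / ε), φ x⟫ :=
    (hrε.norm.const_mul M).mono'
      (hrε.aestronglyMeasurable.inner φ.continuous.aestronglyMeasurable) (.of_forall hrφ_le)
  have hGψ := bdd hGc hGB ψ
  have hfφ := bdd hf hfA φ
  have hder (x : ℝ) : HasDerivAt (fun y => ε * ⟪G (y / ε), φ y⟫)
      (⟪f (x / ε), φ x⟫ - ⟪r (x / ε), φ x⟫ + ε * ⟪G (x / ε), ψ x⟫) x := by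
    have h1 : HasDerivAt (fun y => G (y / ε)) ((1 / ε) • (f (x / ε) - r (x / ε))) x :=
      (hG (x / ε)).scomp x ((hasDerivAt_id x).div_const ε)
    have h2 : HasDerivAt φ (ψ x) x := φ.hasDerivAt x
    refine ((h1.inner ℝ h2).const_mul ε).congr_deriv ?_
    rw [real_inner_smul_left, inner_sub_left]
    field_simp
    ring
  have hzero := integral_eq_zero_of_hasDerivAt_of_integrable hder
    ((hfφ.sub hrφ).add (hGψ.const_mul ε)) ((bdd hGc hGB φ).const_mul ε)
  have hadd := integral_add (hfφ.sub hrφ) (hGψ.const_mul ε)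
  simp only [Pi.sub_apply] at hadd
  rw [hadd, integral_sub hfφ hrφ, integral_const_mul] at hzero
  have heq : ∫ x : ℝ, ⟪f (x / ε), φ x⟫
      = (∫ x : ℝ, ⟪r (x / ε), φ x⟫) - ε * ∫ x : ℝ, ⟪G (x / ε), ψ x⟫ := by linarith
  have hr_bound : ‖∫ x : ℝ, ⟪r (x / ε), φ x⟫‖ ≤ ε * (M * ∫ x, ‖r x‖) := by
    refine (norm_integral_le_of_norm_le (hrε.norm.const_mul M) (.of_forall hrφ_le)).trans_eq ?_
    rw [integral_const_mul, Measure.integral_comp_div (fun y => ‖r y‖) ε, abs_of_pos hε,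
      smul_eq_mul]
    ring
  have hG_bound : ‖∫ x : ℝ, ⟪G (x / ε), ψ x⟫‖ ≤ B * ∫ x, ‖ψ x‖ := by
    rw [← integral_const_mul]
    refine norm_integral_le_of_norm_le (ψ.integrable.norm.const_mul B) (.of_forall fun x => ?_)
    refine (norm_inner_le_norm _ _).trans ?_
    gcongr
    exact hGB _
  rw [heq]
  calc _ ≤ ‖∫ x : ℝ, ⟪r (x / ε), φ x⟫‖ + ‖ε * ∫ x : ℝ, ⟪G (x / ε), ψ x⟫‖ := norm_sub_le _ _
    _ ≤ ε * (M * ∫ x, ‖r x‖) + ε * (B * ∫ x, ‖ψ x‖) := by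
      rw [norm_mul, Real.norm_of_nonneg hε.le]
      gcongr
    _ = _ := by ring

end Oscillation

namespace IsSFShrink

variable {α β c : ℝ} {f g h : ℝ → E3}

lemma isFrenet (H : IsSFShrink α β c f g h) :
    IsFrenet (fun x => c * Real.exp (α * x ^ 2 / 4)) (fun x => -(β * x / 2)) f g h :=
  ⟨H.1, H.2.1, by simpa only [neg_neg] using H.2.2.1⟩

lemma cross_eq (H : IsSFShrink α β c f g h) (x : ℝ) :
    cross (f x) (g x) = h x ∧ cross (g x) (h x) = f x ∧ cross (h x) (f x) = g x := by
  obtain ⟨-, -, -, h1, h2, h3⟩ := id H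
  apply H.isFrenet.cross_eq <;> rw [h1, h2, h3] <;> apply E3.ext_coords <;> simp [e1, e2, e3]

lemma norm_eq_one (H : IsSFShrink α β c f g h) (x : ℝ) : ‖f x‖ = 1 ∧ ‖g x‖ = 1 ∧ ‖h x‖ = 1 := by
  obtain ⟨-, -, -, h1, h2, h3⟩ := id H
  obtain ⟨c1, c2, c3⟩ := H.cross_eq x
  have S := H.isFrenet.sum_sq_norm_eq x
  obtain ⟨n1, n2⟩ := norm_sq_eq_of_cross c1 c2 c3
  have e : ‖f 0‖ ^ 2 + ‖g 0‖ ^ 2 + ‖h 0‖ ^ 2 = 3 := by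
    rw [h1, h2, h3]
    norm_num [e1, e2, e3]
  have one {a : E3} (ha : ‖a‖ ^ 2 = 1) : ‖a‖ = 1 := by
    rwa [pow_eq_one_iff_of_nonneg (norm_nonneg a) two_ne_zero] at ha
  exact ⟨one (by linarith), one (by linarith), one (by linarith)⟩

lemma contDiff (H : IsSFShrink α β c f g h) : ContDiff ℝ (⊤ : ℕ∞) f :=
  H.isFrenet.contDiff (by fun_prop) (by fun_prop)

lemma hasDerivAt_comp_div (H : IsSFShrink α β c f g h) (s x : ℝ) :
    HasDerivAt (fun y => f (y / s)) ((c / s * Real.exp (α * (x / s) ^ 2 / 4)) • g (x / s)) x := by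
  refine ((H.1 (x / s)).scomp x ((hasDerivAt_id x).div_const s)).congr_deriv ?_
  rw [smul_smul]
  congr 1
  ring

lemma deriv_deriv_comp_div (H : IsSFShrink α β c f g h) (s x : ℝ) :
    deriv (deriv fun y => f (y / s)) x =
      (c / s ^ 2 * Real.exp (α * (x / s) ^ 2 / 4)) • ((α * (x / s) / 2) • g (x / s)
        - (c * Real.exp (α * (x / s) ^ 2 / 4)) • f (x / s) - (β * (x / s) / 2) • h (x / s)) := by
  rw [show deriv (fun y => f (y / s)) = _ from funext fun y => (H.hasDerivAt_comp_div s y).deriv]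
  have hy : HasDerivAt (fun y : ℝ => y / s) (1 / s) x := (hasDerivAt_id x).div_const s
  have hk : HasDerivAt (fun y : ℝ => c / s * Real.exp (α * (y / s) ^ 2 / 4))
      (c / s * (Real.exp (α * (x / s) ^ 2 / 4) * (α * (2 * (x / s) * (1 / s)) / 4))) x := by
    refine (((((hy.pow 2).const_mul α).div_const 4).exp).const_mul (c / s)).congr_deriv ?_
    simp
  have hg := (H.2.1 (x / s)).scomp x hy
  refine ((hk.smul hg).congr_deriv ?_).deriv
  simp only [Function.comp_apply]
  module

lemma hasDerivAt_time (H : IsSFShrink α β c f g h) {x t T : ℝ} (ht : t < T) :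
    HasDerivAt (fun s => f (x / Real.sqrt (T - s)))
      ((c / (T - t) * Real.exp (α * (x / Real.sqrt (T - t)) ^ 2 / 4)
        * (x / Real.sqrt (T - t) / 2)) • g (x / Real.sqrt (T - t))) t := by
  have hp : 0 < T - t := sub_pos.2 ht
  have hs : 0 < Real.sqrt (T - t) := Real.sqrt_pos.2 hp
  have h1 : HasDerivAt (fun s => Real.sqrt (T - s)) (-1 / (2 * Real.sqrt (T - t))) t :=
    ((hasDerivAt_id t).const_sub T).sqrt hp.ne'
  have h2 := (hasDerivAt_const t x).div h1 hs.ne'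
  refine ((H.1 _).scomp t h2).congr_deriv ?_
  rw [smul_smul, Pi.div_apply]
  congr 1
  have hsq : Real.sqrt (T - t) ^ 2 = T - t := Real.sq_sqrt hp.le
  rw [← hsq, Real.sqrt_sq hs.le]
  field_simp
  ring

lemma exists_decomposition (H : IsSFShrink α β c f g h) (hα : 0 < α) (hc : 0 < c) :
    ∃ G r : ℝ → E3, (∀ x, HasDerivAt G (f x - r x) x) ∧ (∀ x, ‖G x‖ ≤ c⁻¹) ∧ Integrable r := by
  have gc : Continuous g := continuous_iff_continuousAt.2 fun x => (H.2.1 x).continuousAt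
  have hhc : Continuous h := continuous_iff_continuousAt.2 fun x => (H.2.2.1 x).continuousAt
  refine ⟨fun x => -((c⁻¹ * Real.exp (-(α / 4) * x ^ 2)) • g x),
    fun x => (x * Real.exp (-(α / 4) * x ^ 2)) • (-c⁻¹ • ((β / 2) • h x + (α / 2) • g x)),
    fun x => ?_, fun x => ?_, ?_⟩
  · have hE : HasDerivAt (fun x : ℝ => c⁻¹ * Real.exp (-(α / 4) * x ^ 2))
        (c⁻¹ * (Real.exp (-(α / 4) * x ^ 2) * (-(α / 4) * (2 * x)))) x := by
      refine ((((hasDerivAt_id x).pow 2).const_mul (-(α / 4))).exp.const_mul c⁻¹).congr_deriv ?_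
      simp
    refine (hE.smul (H.2.1 x)).neg.congr_deriv ?_
    have hexp : (c⁻¹ * Real.exp (-(α / 4) * x ^ 2)) * (c * Real.exp (α * x ^ 2 / 4)) = 1 := by
      rw [mul_mul_mul_comm, inv_mul_cancel₀ hc.ne', ← Real.exp_add, one_mul,
        Real.exp_eq_one_iff]
      ring
    rw [smul_add, smul_smul, mul_neg, hexp]
    module
  · rw [norm_neg, norm_smul, (H.norm_eq_one x).2.1, mul_one,
      Real.norm_of_nonneg (by positivity)]
    refine mul_le_of_le_one_right (by positivity) (Real.exp_le_one_iff.2 ?_)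
    nlinarith [sq_nonneg x]
  · refine (integrable_mul_exp_neg_mul_sq (b := α / 4) (by positivity)).norm.mul_const
      (c⁻¹ * (|β / 2| + α / 2)) |>.mono' (by fun_prop) (.of_forall fun x => ?_)
    rw [norm_smul, norm_smul, norm_neg, Real.norm_of_nonneg (inv_nonneg.2 hc.le)]
    gcongr
    refine (norm_add_le _ _).trans_eq ?_
    rw [norm_smul, norm_smul, (H.norm_eq_one x).2.1, (H.norm_eq_one x).2.2, mul_one, mul_one,
      Real.norm_eq_abs, Real.norm_of_nonneg (by positivity)]

end IsSFShrink

/-- the backward self-similar map `m̃(x,t) = f_{c,α}(x/√(T-t))` is a smooth,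
`S²`-valued solution of the LLG equation on `ℝ × (-∞,T)`, with
`|∂ₓ m̃(x,t)| = (c/√(T-t)) e^{αx²/(4(T-t))}`, and it converges to `0` as `t → T⁻` as a
tempered distribution. -/
theorem shrinker_is_LLG_solution
    (α β c T : ℝ) (hα : α ∈ Set.Ioc (0 : ℝ) 1) (hβ : β = Real.sqrt (1 - α ^ 2)) (hc : 0 < c)
    (f g h : ℝ → E3) (hSF : IsSFShrink α β c f g h) :
    ContDiffOn ℝ (⊤ : ℕ∞)
      (fun p : ℝ × ℝ => f (p.1 / Real.sqrt (T - p.2))) (Set.univ ×ˢ Set.Iio T) ∧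
    (∀ x : ℝ, ∀ t : ℝ, t < T → ‖f (x / Real.sqrt (T - t))‖ = 1) ∧
    (∀ x : ℝ, ∀ t : ℝ, t < T →
      deriv (fun s => f (x / Real.sqrt (T - s))) t =
        β • cross (f (x / Real.sqrt (T - t)))
            (deriv (deriv (fun y => f (y / Real.sqrt (T - t)))) x)
          - α • cross (f (x / Real.sqrt (T - t)))
              (cross (f (x / Real.sqrt (T - t)))
                (deriv (deriv (fun y => f (y / Real.sqrt (T - t)))) x))) ∧
    (∀ x : ℝ, ∀ t : ℝ, t < T →
      ‖deriv (fun y => f (y / Real.sqrt (T - t))) x‖ =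
        (c / Real.sqrt (T - t)) * Real.exp (α * x ^ 2 / (4 * (T - t)))) ∧
    (∀ φ : SchwartzMap ℝ E3,
      Tendsto (fun t : ℝ => ∫ x : ℝ, ⟪f (x / Real.sqrt (T - t)), φ x⟫)
        (nhdsWithin T (Set.Iio T)) (nhds 0)) := by
  obtain ⟨hα0, hα1⟩ := hα
  have hβ2 : β ^ 2 = 1 - α ^ 2 := by
    rw [hβ, Real.sq_sqrt]
    nlinarith
  refine ⟨?_, fun x t _ => (hSF.norm_eq_one _).1, fun x t ht => ?_, fun x t ht => ?_,
    fun φ => ?_⟩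
  · refine hSF.contDiff.comp_contDiffOn (contDiffOn_fst.div ?_ ?_)
    · refine ContDiffOn.sqrt (contDiffOn_const.sub contDiffOn_snd) fun p hp => ?_
      exact (sub_pos.2 hp.2).ne'
    · exact fun p hp => (Real.sqrt_pos.2 (sub_pos.2 hp.2)).ne'
  · rw [(hSF.hasDerivAt_time ht).deriv, hSF.deriv_deriv_comp_div,
      Real.sq_sqrt (sub_pos.2 ht).le]
    generalize x / Real.sqrt (T - t) = y
    generalize c / (T - t) * Real.exp (α * y ^ 2 / 4) = q
    generalize c * Real.exp (α * y ^ 2 / 4) = k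
    obtain ⟨c1, -, c3⟩ := hSF.cross_eq y
    have expand (a b d : ℝ) : cross (f y) (a • g y + b • f y + d • h y)
        = a • h y - d • g y := by
      have : cross (f y) (a • g y + b • f y + d • h y)
          = a • cross (f y) (g y) - d • cross (h y) (f y) := by
        apply E3.ext_coords <;> simp <;> ring
      rw [this, c1, c3]
    have e1 : cross (f y) (q • ((α * y / 2) • g y - k • f y - (β * y / 2) • h y))
        = (q * β * y / 2) • g y + (0 : ℝ) • f y + (q * α * y / 2) • h y := by
      rw [show q • ((α * y / 2) • g y - k • f y - (β * y / 2) • h y)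
          = (q * α * y / 2) • g y + (-(q * k)) • f y + (-(q * β * y / 2)) • h y by module, expand]
      module
    rw [e1, expand]
    have hq : q * (y / 2) = β * (q * β * y / 2) + α * (q * α * y / 2) := by
      linear_combination (-(q * y / 2)) * hβ2
    rw [hq]
    module
  · have hp : 0 < T - t := sub_pos.2 ht
    rw [(hSF.hasDerivAt_comp_div _ x).deriv, norm_smul, (hSF.norm_eq_one _).2.1, mul_one,
      Real.norm_of_nonneg (by positivity), div_pow, Real.sq_sqrt hp.le]
    congr 2
    field_simp
  · obtain ⟨G, r, hG, hGB, hr⟩ := hSF.exists_decomposition hα0 hc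
    obtain ⟨K, hK⟩ := exists_norm_integral_inner_comp_div_le hSF.contDiff.continuous
      (fun x => (hSF.norm_eq_one x).1.le) hG hGB hr φ
    refine squeeze_zero_norm' (a := fun t => Real.sqrt (T - t) * K) ?_ ?_
    · filter_upwards [self_mem_nhdsWithin] with t ht
      exact hK _ (Real.sqrt_pos.2 (sub_pos.2 ht))
    · have : Continuous fun t => Real.sqrt (T - t) * K := by fun_prop
      simpa using (this.tendsto T).mono_left nhdsWithin_le_nhds
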